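/- (Symmetric Mountain Pass Theorem.) Let X be an infinite-dimensional real Banach space with X = Y ⊕ Z, where Y is a finite-dimensional subspace. Let J : X → ℝ be continuously Fréchet differentiable and satisfy the Palais–Smale condition (every sequence {u_n} with {J(u_n)} bounded and ‖J'(u_n)‖_{X*} → 0 has a convergent subsequence). Assume: (1) J(0) = 0 and J(−u) = J(u) for all u ∈ X; (2) there are constants ρ, α > 0 such that J(u) ≥ α for all u ∈ Z with ‖u‖ = ρ; (3) for every finite-dimensional subspace W ⊂ X there is R = R(W) > 0 such that J(u) ≤ 0 for all u ∈ W with ‖u‖ ≥ R. Then J has a sequence of critical values c_j → +∞ as j → ∞; in particular there exist u_j ∈ X with J'(u_j) = 0 and J(u_j) → +∞. -/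

import Mathlib

/-- The coboundary of a mod 2 cochain on the cubical lattice. A cell is encoded by twice its
barycentre, so that the dimension of a cell is its number of odd coordinates. -/
def coboundary {m : ℕ} (B : (Fin m → ℤ) → ZMod 2) (c : Fin m → ℤ) : ZMod 2 :=
  ∑ i, if Odd (c i) then B (c + Pi.single i 1) + B (c - Pi.single i 1) else 0

theorem coboundary_add {m : ℕ} (A B : (Fin m → ℤ) → ZMod 2) :
    coboundary (A + B) = coboundary A + coboundary B := by
  ext c
  simp only [coboundary, Pi.add_apply, ← Finset.sum_add_distrib]
  refine Finset.sum_congr rfl fun i _ => ?_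
  split_ifs <;> ring

theorem coboundary_one {m : ℕ} : coboundary (1 : (Fin m → ℤ) → ZMod 2) = 0 := by
  ext c
  simp [coboundary, CharTwo.add_self_eq_zero]

theorem coboundary_coboundary {m : ℕ} (B : (Fin m → ℤ) → ZMod 2) :
    coboundary (coboundary B) = 0 := by
  ext c
  have key : coboundary (coboundary B) c = ∑ p : Fin m × Fin m,
      if p.1 ≠ p.2 ∧ Odd (c p.1) ∧ Odd (c p.2) then
        B (c + Pi.single p.1 1 + Pi.single p.2 1) + B (c + Pi.single p.1 1 - Pi.single p.2 1) +
        (B (c - Pi.single p.1 1 + Pi.single p.2 1) + B (c - Pi.single p.1 1 - Pi.single p.2 1))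
      else 0 := by
    rw [Fintype.sum_prod_type]
    simp only [coboundary]
    refine Finset.sum_congr rfl fun i _ => ?_
    by_cases hi : Odd (c i)
    · rw [if_pos hi, ← Finset.sum_add_distrib]
      refine Finset.sum_congr rfl fun j _ => ?_
      by_cases hij : i = j
      · subst hij
        have h1 : ¬ Odd (c i + 1) := by simpa using hi.add_odd odd_one
        have h2 : ¬ Odd (c i - 1) := by simpa using hi.sub_odd odd_one
        simp [h1, h2]
      · by_cases hj : Odd (c j) <;> simp [hi, hj, hij]
    · simp [hi]
  rw [key]
  refine Finset.sum_involution (fun p _ => p.swap) ?_ ?_ (fun _ _ => Finset.mem_univ _)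
    (fun _ _ => Prod.swap_swap _)
  · rintro ⟨i, j⟩ -
    by_cases h : i ≠ j ∧ Odd (c i) ∧ Odd (c j)
    · have h' : j ≠ i ∧ Odd (c j) ∧ Odd (c i) := ⟨h.1.symm, h.2.2, h.2.1⟩
      simp only [Prod.swap, if_pos h, if_pos h']
      have e1 : c + Pi.single j 1 + Pi.single i 1 = c + Pi.single i 1 + Pi.single j 1 := by abel
      have e2 : c + Pi.single j 1 - Pi.single i 1 = c - Pi.single i 1 + Pi.single j 1 := by abel
      have e3 : c - Pi.single j 1 + Pi.single i 1 = c + Pi.single i 1 - Pi.single j 1 := by abel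
      have e4 : c - Pi.single j 1 - Pi.single i 1 = c - Pi.single i 1 - Pi.single j 1 := by abel
      rw [e1, e2, e3, e4]
      generalize B (c + Pi.single i 1 + Pi.single j 1) = w
      generalize B (c - Pi.single i 1 + Pi.single j 1) = x
      generalize B (c + Pi.single i 1 - Pi.single j 1) = y
      generalize B (c - Pi.single i 1 - Pi.single j 1) = z
      revert w x y z
      decide
    · have h' : ¬ (j ≠ i ∧ Odd (c j) ∧ Odd (c i)) := fun h' => h ⟨h'.1.symm, h'.2.2, h'.2.1⟩
      simp only [Prod.swap, if_neg h, if_neg h', add_zero]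
  · rintro ⟨i, j⟩ - h hs
    have hji : j = i := (Prod.ext_iff.1 hs).1
    simp [hji] at h

theorem coboundary_comp_neg {m : ℕ} (B : (Fin m → ℤ) → ZMod 2) (c : Fin m → ℤ) :
    coboundary B (-c) = coboundary (fun x => B (-x)) c := by
  simp only [coboundary, Pi.neg_apply, odd_neg]
  refine Finset.sum_congr rfl fun i _ => ?_
  have e1 : -(c + Pi.single i 1) = -c - Pi.single i 1 := by abel
  have e2 : -(c - Pi.single i 1) = -c + Pi.single i 1 := by abel
  rw [e1, e2, add_comm (B _)]

theorem coboundary_zero_cell {m : ℕ} (B : (Fin m → ℤ) → ZMod 2) : coboundary B 0 = 0 := by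
  simp [coboundary]

theorem exists_of_coboundary_ne_zero {m : ℕ} {B : (Fin m → ℤ) → ZMod 2} {c : Fin m → ℤ}
    (h : coboundary B c ≠ 0) : ∃ x, (∀ i, |x i - c i| ≤ 1) ∧ B x ≠ 0 := by
  obtain ⟨i, -, hi⟩ := Finset.exists_ne_zero_of_sum_ne_zero h
  have hs : ∀ j, |(Pi.single i 1 : Fin m → ℤ) j| ≤ 1 := fun j => by
    by_cases hj : j = i <;> simp [hj]
  by_contra! hB
  refine hi ?_
  rw [hB (c + Pi.single i 1) fun j => by simpa using hs j,
    hB (c - Pi.single i 1) fun j => by simpa using hs j]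
  simp

theorem support_coboundary_finite {m : ℕ} {B : (Fin m → ℤ) → ZMod 2}
    (hB : B.support.Finite) : (coboundary B).support.Finite := by
  refine (((Set.finite_univ (α := Fin m)).image2 (fun i x => x + Pi.single i 1) hB).union
    ((Set.finite_univ (α := Fin m)).image2 (fun i x => x - Pi.single i 1) hB)).subset ?_
  intro c hc
  obtain ⟨i, -, hi⟩ := Finset.exists_ne_zero_of_sum_ne_zero hc
  by_cases h1 : B (c + Pi.single i 1) = 0
  · by_cases h2 : B (c - Pi.single i 1) = 0
    · simp [h1, h2] at hi
    · exact Or.inl ⟨i, trivial, _, h2, by simp⟩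
  · exact Or.inr ⟨i, trivial, _, h1, by simp⟩

/-- The cells of full dimension in the span of the first `k` coordinates. -/
def fullCells (m k : ℕ) : Set (Fin m → ℤ) :=
  {c | ∀ i : Fin m, ((i : ℕ) < k → Odd (c i)) ∧ (k ≤ i → c i = 0)}

/-- The cells of full dimension in the half of the span of the first `k + 1` coordinates where
the last of these coordinates is positive. -/
def halfCells (m k : ℕ) : Set (Fin m → ℤ) :=
  {c | c ∈ fullCells m (k + 1) ∧ ∀ i : Fin m, (i : ℕ) = k → 0 < c i}

open Classical in
theorem finsum_halfCells_coboundary {m k : ℕ} (hk : k < m) {B : (Fin m → ℤ) → ZMod 2}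
    (hB : B.support.Finite) :
    ∑ᶠ c ∈ halfCells m k, coboundary B c = ∑ᶠ c ∈ fullCells m k, B c := by
  have hfin : ∀ (χ : (Fin m → ℤ) → ZMod 2) (v : Fin m → ℤ),
      (Function.support fun c => χ c * B (c + v)).Finite := fun χ v => by
    refine (hB.image (fun x => x - v)).subset fun c hc => ⟨c + v, ?_, by simp⟩
    exact right_ne_zero_of_mul hc
  let χ : Fin m → (Fin m → ℤ) → ZMod 2 := fun i c => if c ∈ halfCells m k ∧ Odd (c i) then 1 else 0
  have shift : ∀ (i : Fin m) (v : Fin m → ℤ),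
      ∑ᶠ c, χ i c * B (c + v) = ∑ᶠ c, χ i (c - v) * B c := fun i v => by
    rw [← finsum_comp_equiv (Equiv.addRight v) (f := fun c => χ i (c - v) * B c)]
    simp
  have h1 : ∑ᶠ c ∈ halfCells m k, coboundary B c =
      ∑ i, ∑ᶠ c, (χ i (c - Pi.single i 1) + χ i (c + Pi.single i 1)) * B c := by
    have : ∀ c, (∑ᶠ (_ : c ∈ halfCells m k), coboundary B c) =
        ∑ i, (χ i c * B (c + Pi.single i 1) + χ i c * B (c + -Pi.single i 1)) := fun c => by
      by_cases hc : c ∈ halfCells m k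
      · rw [finsum_eq_if, if_pos hc]
        refine Finset.sum_congr rfl fun i _ => ?_
        by_cases hi : Odd (c i) <;> simp [χ, hc, hi, sub_eq_add_neg]
      · simp [χ, hc]
    rw [finsum_congr this, finsum_sum_comm _ _ fun i _ =>
      ((hfin (χ i) _).union (hfin (χ i) _)).subset (Function.support_add _ _)]
    refine Finset.sum_congr rfl fun i _ => ?_
    rw [finsum_add_distrib (hfin _ _) (hfin _ _), shift, shift, ← finsum_add_distrib]
    · refine finsum_congr fun c => ?_
      rw [sub_neg_eq_add, add_mul]
    · exact hB.subset fun c hc => right_ne_zero_of_mul hc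
    · exact hB.subset fun c hc => right_ne_zero_of_mul hc
  rw [h1, Finset.sum_eq_single ⟨k, hk⟩]
  · refine finsum_congr fun c => ?_
    have hmem : ∀ x : Fin m → ℤ, x ∈ halfCells m k ∧ Odd (x ⟨k, hk⟩) ↔
        (∀ j : Fin m, ((j : ℕ) < k → Odd (x j)) ∧ (k < j → x j = 0)) ∧
          Odd (x ⟨k, hk⟩) ∧ 0 < x ⟨k, hk⟩ := fun x => by
      constructor
      · rintro ⟨hx, hx'⟩
        exact ⟨fun j => ⟨fun hj => (hx.1 j).1 (by lia), fun hj => (hx.1 j).2 hj⟩, hx', hx.2 _ rfl⟩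
      · rintro ⟨hx, hx', hpos⟩
        refine ⟨⟨fun j => ⟨fun hj => ?_, fun hj => (hx j).2 hj⟩, fun j hj => ?_⟩, hx'⟩
        · rcases Nat.lt_succ_iff_lt_or_eq.1 hj with hj | hj
          · exact (hx j).1 hj
          · obtain rfl : j = ⟨k, hk⟩ := Fin.ext hj
            exact hx'
        · obtain rfl : j = ⟨k, hk⟩ := Fin.ext hj
          exact hpos
    have hfull : c ∈ fullCells m k ↔
        (∀ j : Fin m, ((j : ℕ) < k → Odd (c j)) ∧ (k < j → c j = 0)) ∧ c ⟨k, hk⟩ = 0 := by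
      constructor
      · intro hc
        exact ⟨fun j => ⟨(hc j).1, fun hj => (hc j).2 hj.le⟩, (hc ⟨k, hk⟩).2 le_rfl⟩
      · rintro ⟨hc, h0⟩ j
        refine ⟨(hc j).1, fun hj => ?_⟩
        rcases hj.lt_or_eq with hj | hj
        · exact (hc j).2 hj
        · obtain rfl : j = ⟨k, hk⟩ := Fin.ext hj.symm
          exact h0
    have hoff : ∀ j : Fin m, j ≠ ⟨k, hk⟩ → (Pi.single ⟨k, hk⟩ 1 : Fin m → ℤ) j = 0 :=
      fun j hj => Pi.single_eq_of_ne hj 1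
    have hQ : ∀ x : Fin m → ℤ, (∀ j, j ≠ ⟨k, hk⟩ → x j = c j) →
        ((∀ j : Fin m, ((j : ℕ) < k → Odd (x j)) ∧ (k < j → x j = 0)) ↔
        (∀ j : Fin m, ((j : ℕ) < k → Odd (c j)) ∧ (k < j → c j = 0))) := fun x hx => by
      refine forall_congr' fun j => ?_
      by_cases hj : j = ⟨k, hk⟩
      · subst hj
        simp
      · rw [hx j hj]
    simp only [χ, hmem, finsum_eq_if, hfull]
    simp only [hQ (c - Pi.single ⟨k, hk⟩ 1) fun j hj => by simp [hoff j hj],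
      hQ (c + Pi.single ⟨k, hk⟩ 1) fun j hj => by simp [hoff j hj]]
    by_cases hc : ∀ j : Fin m, ((j : ℕ) < k → Odd (c j)) ∧ (k < j → c j = 0)
    · simp only [iff_true_intro hc, true_and, Pi.sub_apply, Pi.add_apply, Pi.single_eq_same]
      generalize c ⟨k, hk⟩ = t
      by_cases ht : t = 0
      · subst ht
        simp
      · rw [if_neg ht]
        have : (Odd (t - 1) ∧ 0 < t - 1) ↔ (Odd (t + 1) ∧ 0 < t + 1) := by
          simp only [Int.odd_iff]
          lia
        rw [if_congr this rfl rfl, CharTwo.add_self_eq_zero, zero_mul]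
    · simp only [iff_false_intro hc, false_and, if_false, add_zero, zero_mul]
  · intro i _ hik
    replace hik : (i : ℕ) ≠ k := fun h => hik (Fin.ext h)
    rw [finsum_congr (g := fun _ => 0), finsum_zero]
    intro c
    have hstep : ∀ x y : Fin m → ℤ, (∀ j, j ≠ i → x j = y j) → (Odd (x i) ↔ Odd (y i)) →
        x ∈ halfCells m k ∧ Odd (x i) → y ∈ halfCells m k ∧ Odd (y i) := by
      rintro x y hxy hodd ⟨hx, hxi⟩
      refine ⟨⟨fun j => ?_, fun j hj => ?_⟩, hodd.1 hxi⟩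
      · by_cases hj : j = i
        · subst hj
          refine ⟨fun _ => hodd.1 hxi, fun hj => ?_⟩
          rw [(hx.1 j).2 hj] at hxi
          simp at hxi
        · rw [← hxy j hj]
          exact hx.1 j
      · rw [← hxy j (by rintro rfl; exact hik hj)]
        exact hx.2 j hj
    have hoff : ∀ j, j ≠ i → (c - Pi.single i 1 : Fin m → ℤ) j =
        (c + Pi.single i 1 : Fin m → ℤ) j := fun j hj => by
      simp [Pi.single_eq_of_ne hj]
    have hpar : Odd ((c - Pi.single i 1 : Fin m → ℤ) i) ↔
        Odd ((c + Pi.single i 1 : Fin m → ℤ) i) := by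
      simp only [Pi.sub_apply, Pi.add_apply, Int.odd_sub, Int.odd_add]
    have : χ i (c - Pi.single i 1) = χ i (c + Pi.single i 1) :=
      if_congr ⟨hstep _ _ hoff hpar, hstep _ _ (fun j hj => (hoff j hj).symm) hpar.symm⟩ rfl rfl
    rw [this, CharTwo.add_self_eq_zero, zero_mul]
  · simp

open Classical in
theorem finsum_fullCells_mul {m k : ℕ} {t D : (Fin m → ℤ) → ZMod 2} (hk : k < m)
    (hD : D.support.Finite) (hDneg : ∀ c, D (-c) = D c) (ht : ∀ c, c ≠ 0 → t (-c) = 1 + t c) :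
    ∑ᶠ c ∈ fullCells m (k + 1), t c * D c = ∑ᶠ c ∈ halfCells m k, D c := by
  have hmul : (Function.support fun c => t c * D c).Finite :=
    hD.subset fun c hc => right_ne_zero_of_mul hc
  have hneg : ∀ c, c ∈ fullCells m (k + 1) ↔ -c ∈ fullCells m (k + 1) := fun c => by
    simp [fullCells]
  have hunion : fullCells m (k + 1) = halfCells m k ∪ (-halfCells m k) := by
    ext c
    constructor
    · intro hc
      have h0 : c ⟨k, hk⟩ ≠ 0 := fun h => by
        have := (hc ⟨k, hk⟩).1 (Nat.lt_succ_self k)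
        simp [h] at this
      rcases lt_or_gt_of_ne h0 with h | h
      · refine Or.inr ⟨(hneg c).1 hc, fun i hi => ?_⟩
        obtain rfl : i = ⟨k, hk⟩ := Fin.ext hi
        simpa using h
      · refine Or.inl ⟨hc, fun i hi => ?_⟩
        obtain rfl : i = ⟨k, hk⟩ := Fin.ext hi
        exact h
    · rintro (hc | hc)
      · exact hc.1
      · exact (hneg c).2 hc.1
  have hdisj : Disjoint (halfCells m k) (-halfCells m k) := by
    rw [Set.disjoint_left]
    intro c hc hc'
    have h1 := hc.2 ⟨k, hk⟩ rfl
    have h2 := hc'.2 ⟨k, hk⟩ rfl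
    simp only [Pi.neg_apply] at h2
    linarith
  rw [hunion, finsum_mem_union' hdisj (hmul.subset Set.inter_subset_right)
    (hmul.subset Set.inter_subset_right)]
  have hrefl : ∑ᶠ c ∈ -halfCells m k, t c * D c = ∑ᶠ c ∈ halfCells m k, t (-c) * D (-c) := by
    rw [← Set.image_neg_eq_neg, finsum_mem_image neg_injective.injOn]
  rw [hrefl, ← finsum_mem_add_distrib' (hmul.subset Set.inter_subset_right)]
  · refine finsum_mem_congr rfl fun c hc => ?_
    have h0 : c ≠ 0 := fun h => by
      have := hc.2 ⟨k, hk⟩ rfl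
      simp [h] at this
    rw [ht c h0, hDneg, ← add_mul, add_comm 1, ← add_assoc, CharTwo.add_self_eq_zero, zero_add,
      one_mul]
  · refine hD.subset fun c hc => ?_
    have := right_ne_zero_of_mul hc.2
    rwa [hDneg] at this

/-- The mod 2 cochains counting the cells where the first `k` sign functions all change. -/
def signCochain {m : ℕ} (s : ℕ → (Fin m → ℤ) → ZMod 2) : ℕ → (Fin m → ℤ) → ZMod 2
  | 0 => 1
  | k + 1 => coboundary (s k * signCochain s k)

theorem coboundary_signCochain {m : ℕ} (s : ℕ → (Fin m → ℤ) → ZMod 2) (k : ℕ) :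
    coboundary (signCochain s k) = 0 := by
  cases k with
  | zero => exact coboundary_one
  | succ k => exact coboundary_coboundary _

theorem sign_change_of_signCochain_ne_zero {m : ℕ} (s : ℕ → (Fin m → ℤ) → ZMod 2) (k : ℕ)
    (c : Fin m → ℤ) (hc : signCochain s k c ≠ 0) : ∀ j < k,
      (∃ x, (∀ i, |x i - c i| ≤ k) ∧ s j x ≠ 0) ∧ ∃ x, (∀ i, |x i - c i| ≤ k) ∧ s j x ≠ 1 := by
  induction k generalizing c with
  | zero => simp
  | succ k ih =>
    have hx := exists_of_coboundary_ne_zero hc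
    have hy : coboundary ((1 + s k) * signCochain s k) c ≠ 0 := by
      rw [add_mul, one_mul, coboundary_add, coboundary_signCochain, zero_add]
      exact hc
    replace hy := exists_of_coboundary_ne_zero hy
    obtain ⟨x, hxc, hx⟩ := hx
    obtain ⟨y, hyc, hy⟩ := hy
    have hk : (1 : ℤ) ≤ ((k + 1 : ℕ) : ℤ) := by push_cast; linarith [Nat.cast_nonneg (α := ℤ) k]
    intro j hj
    rcases Nat.lt_succ_iff_lt_or_eq.1 hj with hj | rfl
    · have hw : ∀ w : Fin m → ℤ, (∀ i, |w i - x i| ≤ k) → ∀ i, |w i - c i| ≤ ((k + 1 : ℕ) : ℤ) :=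
        fun w hw i => by
          push_cast
          have := abs_sub_le (w i) (x i) (c i)
          linarith [hw i, hxc i]
      obtain ⟨⟨u, hu, hu'⟩, v, hv, hv'⟩ := ih x (right_ne_zero_of_mul hx) j hj
      exact ⟨⟨u, hw u hu, hu'⟩, v, hw v hv, hv'⟩
    · refine ⟨⟨x, fun i => (hxc i).trans hk, left_ne_zero_of_mul hx⟩,
        y, fun i => (hyc i).trans hk, fun h => hy ?_⟩
      simp [h, CharTwo.add_self_eq_zero]

theorem exists_cell_forall_sign_change {m : ℕ} (s : ℕ → (Fin m → ℤ) → ZMod 2)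
    (hfin : (s 0).support.Finite) (h0 : s 0 0 = 1) (heven : ∀ c, s 0 (-c) = s 0 c)
    (hodd : ∀ j, j ≠ 0 → ∀ c, c ≠ 0 → s j (-c) = 1 + s j c) :
    ∃ c : Fin m → ℤ, ∀ j < m,
      (∃ x, (∀ i, |x i - c i| ≤ m) ∧ s j x ≠ 0) ∧ ∃ x, (∀ i, |x i - c i| ≤ m) ∧ s j x ≠ 1 := by
  have hzero : ∀ k, signCochain s (k + 1) 0 = 0 := fun k => coboundary_zero_cell _
  have hWfin : ∀ k, (signCochain s (k + 1)).support.Finite := fun k => by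
    induction k with
    | zero => exact support_coboundary_finite (hfin.subset fun c hc => left_ne_zero_of_mul hc)
    | succ k ih => exact support_coboundary_finite (ih.subset fun c hc => right_ne_zero_of_mul hc)
  have hWneg : ∀ k c, signCochain s (k + 1) (-c) = signCochain s (k + 1) c := fun k => by
    induction k with
    | zero =>
      intro c
      rw [signCochain, coboundary_comp_neg]
      congr 1
      ext x
      simp [signCochain, heven]
    | succ k ih =>
      intro c
      rw [signCochain, coboundary_comp_neg]
      have : (fun x => (s (k + 1) * signCochain s (k + 1)) (-x)) =
          signCochain s (k + 1) + s (k + 1) * signCochain s (k + 1) := by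
        ext x
        by_cases hx : x = 0
        · simp [hx, hzero]
        · simp [ih, hodd (k + 1) k.succ_ne_zero x hx, add_mul]
      rw [this, coboundary_add, coboundary_signCochain, zero_add]
  have hsum : ∀ k < m, ∑ᶠ c ∈ halfCells m k, signCochain s (k + 1) c = 1 := fun k => by
    induction k with
    | zero =>
      intro hm
      rw [signCochain, finsum_halfCells_coboundary hm (B := s 0 * signCochain s 0)
        (hfin.subset fun c hc => left_ne_zero_of_mul (show s 0 c * _ ≠ 0 from hc))]
      have : fullCells m 0 = {0} := by
        ext c
        simp [fullCells, funext_iff]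
      rw [this, finsum_mem_singleton]
      simp [signCochain, h0]
    | succ k ih =>
      intro hm
      rw [signCochain, finsum_halfCells_coboundary hm (B := s (k + 1) * signCochain s (k + 1))
        ((hWfin k).subset fun c hc =>
          right_ne_zero_of_mul (show s (k + 1) c * _ ≠ 0 from hc))]
      exact (finsum_fullCells_mul (Nat.lt_of_succ_lt hm) (hWfin k) (hWneg k)
        (hodd _ k.succ_ne_zero)).trans (ih (Nat.lt_of_succ_lt hm))
  cases m with
  | zero => exact ⟨0, by simp⟩
  | succ n =>
    obtain ⟨c, -, hc⟩ := exists_ne_zero_of_finsum_mem_ne_zero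
      (ne_of_eq_of_ne (hsum n n.lt_succ_self) one_ne_zero)
    exact ⟨c, sign_change_of_signCochain_ne_zero s (n + 1) c hc⟩

theorem exists_forall_neg_mem_iff_notMem {E : Type*} [AddCommGroup E] [IsAddTorsionFree E] :
    ∃ A : Set E, ∀ x, x ≠ 0 → (-x ∈ A ↔ x ∉ A) := by
  refine ⟨{x | WellOrderingRel x (-x)}, fun x hx => ?_⟩
  simp only [Set.mem_ofPred_eq, neg_neg]
  constructor
  · exact fun h h' => asymm_of WellOrderingRel h h'
  · intro h
    rcases trichotomous_of WellOrderingRel x (-x) with h' | h' | h'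
    · exact absurd h' h
    · exact absurd (self_eq_neg.1 h') hx
    · exact h'

open Classical in
/-- Approximate form of Borsuk's theorem on symmetric neighbourhoods of the origin. -/
theorem exists_forall_sign_change_near {n : ℕ} {f : (Fin (n + 1) → ℝ) → Fin n → ℝ}
    {g : (Fin (n + 1) → ℝ) → ℝ} (hfodd : ∀ x, f (-x) = -f x) (hgeven : ∀ x, g (-x) = g x)
    (hg0 : g 0 < 0) {R : ℝ} (hR : ∀ x, R ≤ ‖x‖ → 0 ≤ g x) {ε : ℝ} (hε : 0 < ε) :
    ∃ q, (∃ x, dist x q ≤ ε ∧ g x < 0) ∧ (∃ x, dist x q ≤ ε ∧ 0 ≤ g x) ∧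
      ∀ j, (∃ x, dist x q ≤ ε ∧ 0 ≤ f x j) ∧ ∃ x, dist x q ≤ ε ∧ f x j ≤ 0 := by
  obtain ⟨A, hA⟩ := exists_forall_neg_mem_iff_notMem (E := Fin (n + 1) → ℝ)
  set h : ℝ := ε / (n + 1) with hh
  have hh0 : 0 < h := by positivity
  let p : (Fin (n + 1) → ℤ) → Fin (n + 1) → ℝ := fun c i => h * c i
  have hpneg : ∀ c, p (-c) = -p c := fun c => by ext i; simp [p]
  have hp0 : ∀ c, c ≠ 0 → p c ≠ 0 := fun c hc hpc => hc <| by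
    ext i
    simpa [p, hh0.ne'] using congrFun hpc i
  have hpdist : ∀ x c : Fin (n + 1) → ℤ, (∀ i, |x i - c i| ≤ ((n + 1 : ℕ) : ℤ)) →
      dist (p x) (p c) ≤ ε := fun x c hxc => by
    refine (dist_pi_le_iff hε.le).2 fun i => ?_
    have h1 : |((x i : ℝ) - c i)| ≤ n + 1 := by exact_mod_cast hxc i
    rw [Real.dist_eq, ← mul_sub, abs_mul, abs_of_pos hh0]
    calc h * |(x i : ℝ) - c i| ≤ h * (n + 1) := by gcongr
      _ = ε := by rw [hh]; field_simp
  let F : ℕ → (Fin (n + 1) → ℝ) → ℝ := fun j x => if hj : j < n then f x ⟨j, hj⟩ else 0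
  have hF : ∀ j x, F j (-x) = -F j x := fun j x => by
    by_cases hj : j < n <;> simp [F, hj, hfodd]
  let s : ℕ → (Fin (n + 1) → ℤ) → ZMod 2
    | 0, c => if g (p c) < 0 then 1 else 0
    | j + 1, c => if 0 < F j (p c) ∨ F j (p c) = 0 ∧ p c ∈ A then 1 else 0
  have hsfin : (s 0).support.Finite := by
    obtain ⟨K, hK⟩ := exists_nat_ge (R / h)
    refine (Set.finite_Icc (fun _ => -(K : ℤ)) fun _ => (K : ℤ)).subset fun c hc => ?_
    have hneg : g (p c) < 0 := by
      by_contra hneg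
      simp [s, hneg] at hc
    have hnorm : ‖p c‖ < R := lt_of_not_ge fun hle => hneg.not_ge (hR _ hle)
    have hci : ∀ i, |c i| ≤ (K : ℤ) := fun i => by
      have h1 := (norm_le_pi_norm (p c) i).trans hnorm.le
      rw [Real.norm_eq_abs, abs_mul, abs_of_pos hh0, ← le_div_iff₀' hh0] at h1
      exact_mod_cast h1.trans hK
    exact ⟨fun i => (abs_le.1 (hci i)).1, fun i => (abs_le.1 (hci i)).2⟩
  have hszero : s 0 0 = 1 := by
    have : p 0 = 0 := by ext i; simp [p]
    simp [s, this, hg0]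
  have hseven : ∀ c, s 0 (-c) = s 0 c := by
    intro c
    simp [s, hpneg, hgeven]
  have hsodd : ∀ j, j ≠ 0 → ∀ c, c ≠ 0 → s j (-c) = 1 + s j c := by
    intro j hj c hc
    obtain ⟨j, rfl⟩ := Nat.exists_eq_succ_of_ne_zero hj
    have hiff : (0 < F j (p (-c)) ∨ F j (p (-c)) = 0 ∧ p (-c) ∈ A) ↔
        ¬ (0 < F j (p c) ∨ F j (p c) = 0 ∧ p c ∈ A) := by
      rw [hpneg, hF, hA _ (hp0 c hc)]
      rcases lt_trichotomy (F j (p c)) 0 with h | h | h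
      · simp [h, h.ne, h.not_gt]
      · simp [h]
      · simp [h, h.ne', h.not_gt]
    by_cases hpos : 0 < F j (p c) ∨ F j (p c) = 0 ∧ p c ∈ A
    · simp only [s, if_pos hpos, if_neg fun h => hiff.1 h hpos, CharTwo.add_self_eq_zero]
    · simp only [s, if_neg hpos, if_pos (hiff.2 hpos), add_zero]
  obtain ⟨c, hc⟩ := exists_cell_forall_sign_change s hsfin hszero hseven hsodd
  refine ⟨p c, ?_, ?_, fun j => ⟨?_, ?_⟩⟩
  · obtain ⟨x, hx, hsx⟩ := (hc 0 n.succ_pos).1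
    refine ⟨p x, hpdist x c hx, ?_⟩
    by_contra hneg
    simp [s, hneg] at hsx
  · obtain ⟨x, hx, hsx⟩ := (hc 0 n.succ_pos).2
    refine ⟨p x, hpdist x c hx, ?_⟩
    by_contra! hneg
    simp [s, hneg] at hsx
  · obtain ⟨x, hx, hsx⟩ := (hc (j + 1) (Nat.succ_lt_succ j.2)).1
    refine ⟨p x, hpdist x c hx, ?_⟩
    have : 0 < F j (p x) ∨ F j (p x) = 0 ∧ p x ∈ A := by
      by_contra hneg
      simp only [s, if_neg hneg, ne_eq, not_true_eq_false] at hsx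
    have hFj : F j (p x) = f (p x) j := by simp [F]
    rw [← hFj]
    rcases this with h | h
    exacts [h.le, h.1.ge]
  · obtain ⟨x, hx, hsx⟩ := (hc (j + 1) (Nat.succ_lt_succ j.2)).2
    refine ⟨p x, hpdist x c hx, ?_⟩
    have : ¬ (0 < F j (p x) ∨ F j (p x) = 0 ∧ p x ∈ A) := fun hpos => by
      simp only [s, if_pos hpos, ne_eq, not_true_eq_false] at hsx
    have hFj : F j (p x) = f (p x) j := by simp [F]
    rw [← hFj]
    exact not_lt.1 fun h => this (Or.inl h)

/-- Borsuk's theorem on symmetric neighbourhoods of the origin: an odd map to a space of smaller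
dimension has a zero on the boundary of every bounded symmetric neighbourhood of `0`, here given
as a sublevel set of an even function. -/
theorem exists_zero_of_odd_of_even {n : ℕ} {f : (Fin (n + 1) → ℝ) → Fin n → ℝ}
    {g : (Fin (n + 1) → ℝ) → ℝ} (hf : Continuous f) (hg : Continuous g)
    (hfodd : ∀ x, f (-x) = -f x) (hgeven : ∀ x, g (-x) = g x)
    (hg0 : g 0 < 0) {R : ℝ} (hR : ∀ x, R ≤ ‖x‖ → 0 ≤ g x) : ∃ x, f x = 0 ∧ g x = 0 := by
  have key := fun N : ℕ => exists_forall_sign_change_near hfodd hgeven hg0 hR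
    (Nat.one_div_pos_of_nat (α := ℝ) (n := N))
  choose q hq₁ hq₂ hq₃ using key
  choose x hxq hx using hq₁
  have hbdd : ∀ N, q N ∈ Metric.closedBall (0 : Fin (n + 1) → ℝ) (R + 1) := fun N => by
    have h1 : ‖x N‖ < R := lt_of_not_ge fun h => (hx N).not_ge (hR _ h)
    have h2 : (1 : ℝ) / (N + 1) ≤ 1 := by
      rw [div_le_one (by positivity)]
      linarith [Nat.cast_nonneg (α := ℝ) N]
    have h3 := norm_le_norm_add_norm_sub' (q N) (x N)
    rw [← dist_eq_norm, dist_comm] at h3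
    rw [mem_closedBall_zero_iff]
    linarith [hxq N]
  obtain ⟨y, -, φ, hφ, hy⟩ := (isCompact_closedBall _ _).tendsto_subseq hbdd
  have hlim : ∀ z : ℕ → Fin (n + 1) → ℝ, (∀ N, dist (z N) (q N) ≤ 1 / ((N : ℝ) + 1)) →
      Filter.Tendsto (fun N => z (φ N)) Filter.atTop (nhds y) := fun z hz => by
    rw [tendsto_iff_of_dist (f₂ := q ∘ φ)]
    · exact hy
    · exact squeeze_zero (fun _ => dist_nonneg) (fun N => hz (φ N))
        (tendsto_one_div_add_atTop_nhds_zero_nat.comp hφ.tendsto_atTop)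
  have hnonneg : ∀ F : (Fin (n + 1) → ℝ) → ℝ, Continuous F →
      (∀ N, ∃ z, dist z (q N) ≤ 1 / ((N : ℝ) + 1) ∧ 0 ≤ F z) → 0 ≤ F y := fun F hF hz => by
    choose z hzq hz using hz
    exact ge_of_tendsto' ((hF.tendsto y).comp (hlim z hzq)) fun N => hz (φ N)
  refine ⟨y, funext fun j => le_antisymm ?_ ?_, le_antisymm ?_ ?_⟩
  · refine neg_nonneg.1 (hnonneg (fun z => -f z j) (by fun_prop) fun N => ?_)
    obtain ⟨z, hz, hz'⟩ := (hq₃ N j).2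
    exact ⟨z, hz, neg_nonneg.2 hz'⟩
  · exact hnonneg (fun z => f z j) (by fun_prop) fun N => (hq₃ N j).1
  · exact neg_nonneg.1 (hnonneg (fun z => -g z) hg.neg fun N =>
      ⟨x N, hxq N, neg_nonneg.2 (hx N).le⟩)
  · exact hnonneg g hg hq₂

/-- Ekeland's variational principle. -/
theorem exists_forall_le_add_mul_dist {α : Type*} [MetricSpace α] [CompleteSpace α] {φ : α → ℝ}
    (hφ : LowerSemicontinuous φ) (hb : BddBelow (Set.range φ)) (x₀ : α) {κ : ℝ} (hκ : 0 < κ) :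
    ∃ y, φ y + κ * dist x₀ y ≤ φ x₀ ∧ ∀ z, φ y ≤ φ z + κ * dist y z := by
  let S : α → Set α := fun x => {z | φ z + κ * dist x z ≤ φ x}
  have hSself : ∀ x, x ∈ S x := fun x => by simp [S]
  have hStrans : ∀ {x y z}, y ∈ S x → z ∈ S y → z ∈ S x := by
    intro x y z hy hz
    have := mul_le_mul_of_nonneg_left (dist_triangle x y z) hκ.le
    simp only [S, Set.mem_ofPred_eq] at hy hz ⊢
    linarith
  have hnext : ∀ (n : ℕ) x, ∃ z ∈ S x, ∀ w ∈ S x, φ z ≤ φ w + 1 / ((n : ℝ) + 1) := fun n x => by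
    have hne : (φ '' S x).Nonempty := ⟨_, x, hSself x, rfl⟩
    have hlt : sInf (φ '' S x) < sInf (φ '' S x) + 1 / ((n : ℝ) + 1) := by
      linarith [Nat.one_div_pos_of_nat (α := ℝ) (n := n)]
    obtain ⟨_, ⟨z, hz, rfl⟩, hzlt⟩ := exists_lt_of_csInf_lt hne hlt
    refine ⟨z, hz, fun w hw => ?_⟩
    have := csInf_le (hb.mono (Set.image_subset_range _ _)) (Set.mem_image_of_mem φ hw)
    linarith
  choose next hnextS hnextle using hnext
  let x : ℕ → α := fun n => Nat.rec x₀ next n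
  have hmem : ∀ n m, n ≤ m → x m ∈ S (x n) := fun n m hnm => by
    induction m, hnm using Nat.le_induction with
    | base => exact hSself _
    | succ m _ ih => exact hStrans ih (hnextS m (x m))
  have hanti : Antitone fun n => φ (x n) := fun n m hnm => by
    have h1 : φ (x m) + κ * dist (x n) (x m) ≤ φ (x n) := hmem n m hnm
    have h2 : 0 ≤ κ * dist (x n) (x m) := by positivity
    change φ (x m) ≤ φ (x n)
    linarith
  have hconv := tendsto_atTop_ciInf hanti (hb.mono (Set.range_comp_subset_range x φ))
  set L := ⨅ n, φ (x n)
  have hL : ∀ n, L ≤ φ (x n) := fun n => hanti.le_of_tendsto hconv n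
  have hcauchy : CauchySeq x := by
    refine cauchySeq_of_le_tendsto_0' (fun n => (φ (x n) - L) / κ) (fun n m hnm => ?_) ?_
    · have h1 : φ (x m) + κ * dist (x n) (x m) ≤ φ (x n) := hmem n m hnm
      rw [le_div_iff₀' hκ]
      linarith [hL m]
    · simpa using (hconv.sub_const L).div_const κ
  obtain ⟨y, hy⟩ := cauchySeq_tendsto_of_complete hcauchy
  have hyS : ∀ n, y ∈ S (x n) := fun n => by
    have hclosed : IsClosed (S (x n)) :=
      (hφ.add (by fun_prop : Continuous fun z => κ * dist (x n) z).lowerSemicontinuous)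
        |>.isClosed_preimage _
    exact hclosed.mem_of_tendsto hy (Filter.eventually_atTop.2 ⟨n, hmem n⟩)
  refine ⟨y, hyS 0, fun z => ?_⟩
  by_contra! hz
  have hzS : z ∈ S y := hz.le
  have hle : ∀ n : ℕ, φ (x (n + 1)) ≤ φ z + 1 / ((n : ℝ) + 1) := fun n =>
    hnextle n (x n) z (hStrans (hyS n) hzS)
  have h1 : L ≤ φ z := by
    refine le_of_tendsto_of_tendsto' (hconv.comp (Filter.tendsto_add_atTop_nat 1)) ?_ hle
    simpa using tendsto_one_div_add_atTop_nhds_zero_nat.const_add (φ z)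
  have h2 : φ y ≤ L := by
    refine ge_of_tendsto' hconv fun n => ?_
    have h1 : φ y + κ * dist (x n) y ≤ φ (x n) := hyS n
    have h2 : 0 ≤ κ * dist (x n) y := by positivity
    linarith
  have h3 : 0 ≤ κ * dist y z := by positivity
  linarith

theorem exists_clm_ne_zero_on_thickening {X : Type*} [NormedAddCommGroup X] [NormedSpace ℝ X]
    {K : Set X} (hK : IsCompact K) (h0 : (0 : X) ∉ K) :
    ∃ (q : ℕ) (g : X →L[ℝ] (Fin q → ℝ)) (δ : ℝ), 0 < δ ∧ (K = ∅ → q = 0) ∧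
      ∀ u ∈ Metric.thickening δ K, g u ≠ 0 := by
  rcases K.eq_empty_or_nonempty with rfl | hne
  · exact ⟨0, 0, 1, one_pos, fun _ => rfl, by simp⟩
  obtain ⟨t, ht⟩ := hK.elim_finite_subcover (fun l : X →L[ℝ] ℝ => {u | l u ≠ 0})
    (fun l => isOpen_ne_fun l.continuous continuous_const) fun u hu => by
      obtain ⟨l, hl⟩ := SeparatingDual.exists_ne_zero (R := ℝ) (x := u) fun h => h0 (h ▸ hu)
      exact Set.mem_iUnion.2 ⟨l, hl⟩
  obtain ⟨δ, hδ, hsub⟩ := hK.exists_thickening_subset_open (isOpen_biUnion fun l _ =>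
    isOpen_ne_fun (ContinuousLinearMap.continuous l) continuous_const) ht
  refine ⟨t.card, ContinuousLinearMap.pi fun i => (t.equivFin.symm i : X →L[ℝ] ℝ), δ, hδ,
    fun h => absurd h hne.ne_empty, fun u hu h => ?_⟩
  obtain ⟨l, hl, hlu⟩ := Set.mem_iUnion₂.1 (hsub hu)
  refine hlu ?_
  simpa using congrFun h (t.equivFin ⟨l, hl⟩)

section PalaisSmale

variable {X : Type*} [NormedAddCommGroup X] [NormedSpace ℝ X] {J : X → ℝ} {J' : X → (X →L[ℝ] ℝ)}

theorem isCompact_criticalSet (hJ : Continuous J) (hJ' : Continuous J')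
    (hPS : ∀ un : ℕ → X, (∃ B, ∀ n, |J (un n)| ≤ B) →
      Filter.Tendsto (fun n => ‖J' (un n)‖) Filter.atTop (nhds 0) →
      ∃ (ψ : ℕ → ℕ) (x : X), StrictMono ψ ∧
        Filter.Tendsto (fun n => un (ψ n)) Filter.atTop (nhds x)) (c : ℝ) :
    IsCompact {u | J' u = 0 ∧ J u = c} := by
  refine IsSeqCompact.isCompact fun u hu => ?_
  obtain ⟨ψ, x, hψ, hx⟩ := hPS u ⟨|c|, fun n => by rw [(hu n).2]⟩ (by simp [(hu _).1])
  have hclosed : IsClosed {u | J' u = 0 ∧ J u = c} :=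
    (isClosed_eq hJ' continuous_const).inter (isClosed_eq hJ continuous_const)
  exact ⟨x, hclosed.mem_of_tendsto hx (Filter.Eventually.of_forall fun n => hu _), ψ, hψ, hx⟩

theorem exists_pos_le_norm_derivative (hJ : Continuous J) (hJ' : Continuous J')
    (hPS : ∀ un : ℕ → X, (∃ B, ∀ n, |J (un n)| ≤ B) →
      Filter.Tendsto (fun n => ‖J' (un n)‖) Filter.atTop (nhds 0) →
      ∃ (ψ : ℕ → ℕ) (x : X), StrictMono ψ ∧
        Filter.Tendsto (fun n => un (ψ n)) Filter.atTop (nhds x)) (c : ℝ) {N : Set X}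
    (hN : IsOpen N) (hcN : ∀ u, J' u = 0 → J u = c → u ∈ N) :
    ∃ σ > 0, ∀ u, |J u - c| ≤ σ → u ∉ N → σ ≤ ‖J' u‖ := by
  by_contra! hcon
  choose u hu huN hu' using fun n : ℕ => hcon _ (Nat.one_div_pos_of_nat (α := ℝ) (n := n))
  have hlim := tendsto_one_div_add_atTop_nhds_zero_nat (𝕜 := ℝ)
  obtain ⟨ψ, x, hψ, hx⟩ := hPS u ⟨|c| + 1, fun n => by
      have h1 : (1 : ℝ) / (n + 1) ≤ 1 := by
        rw [div_le_one (by positivity)]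
        linarith [Nat.cast_nonneg (α := ℝ) n]
      have h2 := abs_sub_abs_le_abs_sub (J (u n)) c
      linarith [hu n]⟩
    (squeeze_zero (fun _ => norm_nonneg _) (fun n => (hu' n).le) hlim)
  have hlim' := hlim.comp hψ.tendsto_atTop
  have h1 : J' x = 0 := by
    rw [← norm_le_zero_iff]
    exact le_of_tendsto_of_tendsto' ((hJ'.tendsto x).comp hx).norm hlim' fun n => (hu' _).le
  have h2 : J x = c := by
    rw [← sub_eq_zero, ← abs_nonpos_iff]
    exact le_of_tendsto_of_tendsto' (((hJ.tendsto x).comp hx).sub_const c).abs hlim'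
      fun n => hu _
  exact hN.isClosed_compl.mem_of_tendsto hx (Filter.Eventually.of_forall fun n => huN _)
    (hcN x h1 h2)

end PalaisSmale

theorem exists_odd_descent_field {V X : Type*} [NormedAddCommGroup V] [NormedAddCommGroup X]
    [NormedSpace ℝ X] {A : V → (X →L[ℝ] ℝ)} (hA : Continuous A) (hAodd : ∀ x, A (-x) = -A x)
    {C O : Set V} (hC : IsClosed C) (hO : IsOpen O) (hCO : C ⊆ O) (hCneg : ∀ x ∈ C, -x ∈ C)
    (hOneg : ∀ x ∈ O, -x ∈ O) {σ : ℝ} (hσ : ∀ x ∈ C, σ < ‖A x‖) :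
    ∃ v : V → X, Continuous v ∧ (∀ x, v (-x) = -v x) ∧ (∀ x, ‖v x‖ ≤ 1) ∧
      (∀ x ∉ O, v x = 0) ∧ ∀ x ∈ C, A x (v x) < -σ := by
  let T : V → Set X := fun x => {w | ‖w‖ ≤ 1 ∧ (x ∉ O → w = 0) ∧ (x ∈ C → A x w < -σ)}
  have hT : ∀ x, Convex ℝ (T x) := fun x => by
    have h1 : Convex ℝ {w : X | ‖w‖ ≤ 1} := by
      simpa only [Metric.closedBall, dist_zero_right] using convex_closedBall (0 : X) 1
    have h2 : Convex ℝ {w : X | x ∉ O → w = 0} := by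
      by_cases hx : x ∈ O
      · simpa [hx] using convex_univ
      · simp [hx]
    have h3 : Convex ℝ {w : X | x ∈ C → A x w < -σ} := by
      by_cases hx : x ∈ C
      · simpa [hx] using convex_halfSpace_lt (A x).toLinearMap.isLinear (-σ)
      · simpa [hx] using convex_univ
    exact h1.inter (h2.inter h3)
  obtain ⟨w, hw⟩ := exists_continuous_forall_mem_convex_of_local_const hT fun x => by
    by_cases hx : x ∈ C
    · obtain ⟨u, hu, hu'⟩ := (A x).exists_lt_apply_of_lt_opNorm (hσ x hx)
      obtain ⟨v, hv, hv'⟩ : ∃ v, ‖v‖ < 1 ∧ A x v < -σ := by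
        rcases lt_abs.1 hu' with h | h
        · exact ⟨-u, by rwa [norm_neg], by simpa using h⟩
        · exact ⟨u, hu, lt_neg_of_lt_neg h⟩
      refine ⟨v, ?_⟩
      have hcont : Continuous fun y => A y v := by fun_prop
      filter_upwards [hO.mem_nhds (hCO hx), hcont.continuousAt.eventually_lt_const hv']
        with y hy hy'
      exact ⟨hv.le, fun h => absurd hy h, fun _ => hy'⟩
    · refine ⟨0, ?_⟩
      filter_upwards [hC.isOpen_compl.mem_nhds hx] with y hy
      exact ⟨by simp, fun _ => rfl, fun h => absurd h hy⟩
  refine ⟨fun x => (2⁻¹ : ℝ) • (w x - w (-x)), by fun_prop, fun x => ?_, fun x => ?_,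
    fun x hx => ?_, fun x hx => ?_⟩
  · simp only [neg_neg, ← smul_neg, neg_sub]
  · have h1 := norm_sub_le (w x) (w (-x))
    have h2 := (hw x).1
    have h3 := (hw (-x)).1
    rw [norm_smul, Real.norm_of_nonneg (by norm_num)]
    linarith
  · have h1 := (hw x).2.1 hx
    have h2 := (hw (-x)).2.1 fun h => hx (by simpa using hOneg _ h)
    simp [h1, h2]
  · have h1 := (hw x).2.2 hx
    have h2 := (hw (-x)).2.2 (hCneg x hx)
    rw [hAodd, neg_apply] at h2
    simp only [map_smul, map_sub, smul_eq_mul]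
    linarith

theorem eventually_le_sub_of_descent {V X : Type*} [TopologicalSpace V] [NormedAddCommGroup X]
    [NormedSpace ℝ X] {J : X → ℝ} {J' : X → (X →L[ℝ] ℝ)} (hJ : ∀ x, HasStrictFDerivAt J (J' x) x)
    {C : Set V} (hC : IsCompact C) {h v : V → X} (hh : Continuous h) (hv : Continuous v) {M s : ℝ}
    (hle : ∀ x ∈ C, J (h x) ≤ M) (hdesc : ∀ x ∈ C, M ≤ J (h x) → J' (h x) (v x) < -s) :
    ∀ᶠ t in nhdsWithin (0 : ℝ) (Set.Ioi 0), ∀ x ∈ C, J (h x + t • v x) ≤ M - t * s := by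
  have key : ∀ᶠ t in nhds (0 : ℝ), ∀ x ∈ C, 0 < t → x ∈ C → J (h x + t • v x) ≤ M - t * s := by
    refine hC.eventually_forall_of_forall_eventually fun x hx => ?_
    have hJc : Continuous J := continuous_iff_continuousAt.2 fun x => (hJ x).continuousAt
    rcases lt_or_ge (J (h x)) M with hlt | hge
    · have hcont : Continuous fun z : ℝ × V => J (h z.2 + z.1 • v z.2) + z.1 * s := by fun_prop
      have := (hcont.tendsto (0, x)).eventually_lt_const (u := M) (by simpa using hlt)
      filter_upwards [this] with z hz _ _
      linarith
    · obtain ⟨δ, hδ, hδ'⟩ := exists_pos_mul_lt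
        (show 0 < -s - J' (h x) (v x) by linarith [hdesc x hx hge]) ‖v x‖
      have hcont : Continuous fun z : ℝ × V => J' (h x) (v z.2) + δ * ‖v z.2‖ := by fun_prop
      have h1 := (hcont.tendsto (0, x)).eventually_lt_const (u := -s) (by linarith)
      have hlim : Filter.Tendsto (fun z : ℝ × V => (h z.2 + z.1 • v z.2, h z.2))
          (nhds (0, x)) (nhds (h x, h x)) := by
        have : Continuous fun z : ℝ × V => (h z.2 + z.1 • v z.2, h z.2) := by fun_prop
        simpa using this.tendsto (0, x)
      have h2 := hlim.eventually ((hJ (h x)).isLittleO.bound hδ)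
      filter_upwards [h1, h2] with z hz1 hz2 hz0 hzC
      have h3 := (abs_le.1 hz2).2
      simp only [add_sub_cancel_left, map_smul, smul_eq_mul, norm_smul,
        Real.norm_of_nonneg hz0.le] at h3
      have h4 := mul_lt_mul_of_pos_left hz1 hz0
      have h5 := hle z.2 hzC
      nlinarith
  filter_upwards [key.filter_mono nhdsWithin_le_nhds, self_mem_nhdsWithin] with t ht ht0 x hx
  exact ht x hx ht0 hx

open scoped BoundedContinuousFunction in
theorem exists_odd_perturbation_forall_le {V X : Type*} [NormedAddCommGroup V]
    [NormedAddCommGroup X] [NormedSpace ℝ X] [CompleteSpace X] {J : X → ℝ} {J' : X → (X →L[ℝ] ℝ)}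
    (hJ : ∀ x, HasStrictFDerivAt J (J' x) x) (hJ' : Continuous J') (hodd : ∀ u, J' (-u) = -J' u)
    (hJeven : ∀ u, J (-u) = J u) {h : V → X} (hh : Continuous h) (hhodd : ∀ x, h (-x) = -h x)
    {C : Set V} (hC : IsCompact C) (hCneg : ∀ x ∈ C, -x ∈ C) {R c ε l κ s : ℝ} (hκ : 0 < κ)
    (hκs : κ < s) (hεl : 2 * ε ≤ κ * l) (hle : ∀ x ∈ C, J (h x) ≤ c + ε)
    (hR : ∀ x, R ≤ ‖x‖ → J (h x) ≤ c - ε)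
    (hs : ∀ x ∈ C, ∀ u, ‖u - h x‖ < l → |J u - c| ≤ ε → s < ‖J' u‖) :
    ∃ k : V → X, Continuous k ∧ (∀ x, k (-x) = -k x) ∧ (∀ x, R ≤ ‖x‖ → k x = 0) ∧
      ∀ x ∈ C, J (h x + k x) ≤ c - ε := by
  by_contra! hcon
  let S : Set (V →ᵇ X) := {k | (∀ x, k (-x) = -k x) ∧ ∀ x, R ≤ ‖x‖ → k x = 0}
  have hSclosed : IsClosed S := by
    simp only [S, Set.ofPred_and, Set.ofPred_forall]
    refine IsClosed.inter (isClosed_iInter fun x => ?_)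
      (isClosed_iInter fun x => isClosed_iInter fun _ => ?_)
    · exact isClosed_eq (continuous_eval_const _)
        (continuous_eval_const _).neg
    · exact isClosed_eq (continuous_eval_const _) continuous_const
  have : CompleteSpace S := hSclosed.completeSpace_coe
  have hJc : Continuous J := continuous_iff_continuousAt.2 fun x => (hJ x).continuousAt
  have hgt : ∀ k : S, ∃ x ∈ C, c - ε < J (h x + k.1 x) := fun k =>
    hcon k.1 k.1.continuous k.2.1 k.2.2
  have hmax : ∀ k : S, ∃ x ∈ C, ∀ y ∈ C, J (h y + k.1 y) ≤ J (h x + k.1 x) := fun k => by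
    obtain ⟨x, hx, -⟩ := hgt k
    exact hC.exists_isMaxOn ⟨x, hx⟩
      (by fun_prop : Continuous fun x => J (h x + k.1 x)).continuousOn
  choose m hmC hm using hmax
  let φ : S → ℝ := fun k => J (h (m k) + k.1 (m k))
  have hφgt : ∀ k, c - ε < φ k := fun k => by
    obtain ⟨x, hx, hxk⟩ := hgt k
    exact hxk.trans_le (hm k x hx)
  have hφlsc : LowerSemicontinuous φ := by
    refine lowerSemicontinuous_iff_isClosed_preimage.2 fun r => ?_
    have heq : φ ⁻¹' Set.Iic r = ⋂ x ∈ C, {k : S | J (h x + k.1 x) ≤ r} := by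
      ext k
      simp only [Set.mem_preimage, Set.mem_Iic, Set.mem_iInter, Set.mem_ofPred_eq]
      exact ⟨fun hk x hx => (hm k x hx).trans hk, fun hk => hk _ (hmC k)⟩
    rw [heq]
    refine isClosed_biInter fun x _ => isClosed_le (hJc.comp ?_) continuous_const
    exact continuous_const.add
      ((continuous_eval_const x).comp continuous_subtype_val)
  let k₀ : S := ⟨0, by simp, by simp⟩
  obtain ⟨k, hk, hkmin⟩ := exists_forall_le_add_mul_dist hφlsc
    ⟨c - ε, Set.forall_mem_range.2 fun k => (hφgt k).le⟩ k₀ hκ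
  have hφ0 : φ k₀ ≤ c + ε := by simpa [φ, k₀] using hle _ (hmC k₀)
  have hφk : φ k ≤ c + ε := by
    have : 0 ≤ κ * dist k₀ k := by positivity
    linarith
  have hkl : ‖k.1‖ < l := by
    have h1 : dist k₀ k = ‖k.1‖ := by rw [Subtype.dist_eq, dist_zero_left]
    rw [h1] at hk
    refine lt_of_mul_lt_mul_left ?_ hκ.le
    linarith [hφgt k]
  have hh₁ : Continuous fun x => h x + k.1 x := by fun_prop
  have hh₁odd : ∀ x, h (-x) + k.1 (-x) = -(h x + k.1 x) := fun x => by
    rw [hhodd, k.2.1, neg_add]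
  let C' : Set V := C ∩ {x | φ k ≤ J (h x + k.1 x)}
  obtain ⟨v, hv, hvodd, hv1, hv0, hvdesc⟩ := exists_odd_descent_field
    (A := fun x => J' (h x + k.1 x)) (C := C') (O := {x | ‖x‖ < R}) (σ := s) (hJ'.comp hh₁)
    (fun x => by rw [hh₁odd, hodd])
    (hC.isClosed.inter (isClosed_le continuous_const (hJc.comp hh₁)))
    (isOpen_lt continuous_norm continuous_const)
    (fun x hx => by
      by_contra hxR
      have hxR : R ≤ ‖x‖ := not_lt.1 hxR
      have h1 : φ k ≤ J (h x + k.1 x) := hx.2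
      rw [k.2.2 x hxR, add_zero] at h1
      linarith [hφgt k, hR x hxR])
    (fun x hx => ⟨hCneg x hx.1, by
      have h1 : φ k ≤ J (h x + k.1 x) := hx.2
      change φ k ≤ J (h (-x) + k.1 (-x))
      rwa [hh₁odd, hJeven]⟩)
    (fun x hx => by simpa using hx)
    (fun x hx => by
      have h1 : φ k ≤ J (h x + k.1 x) := hx.2
      refine hs x hx.1 _ ?_ (abs_le.2 ⟨?_, ?_⟩)
      · rw [add_sub_cancel_left]
        exact (k.1.norm_coe_le_norm x).trans_lt hkl
      · linarith [hφgt k]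
      · linarith [hm k x hx.1])
  obtain ⟨t, ht, ht0⟩ := ((eventually_le_sub_of_descent hJ hC hh₁ hv (hm k) fun x hx hxM =>
    hvdesc x ⟨hx, hxM⟩).and self_mem_nhdsWithin).exists
  have ht0 : 0 < t := ht0
  let w : V →ᵇ X := BoundedContinuousFunction.ofNormedAddCommGroup v hv 1 hv1
  let k' : S := ⟨k.1 + t • w, fun x => by
      simp [w, k.2.1, hvodd, add_comm], fun x hx => by
      simp [w, k.2.2 x hx, hv0 x (not_lt.2 hx)]⟩
  have h1 : φ k' ≤ φ k - t * s := by
    simpa [φ, k', w, add_assoc] using ht (m k') (hmC k')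
  have h2 : dist k k' ≤ t := by
    rw [Subtype.dist_eq, dist_eq_norm]
    simp only [k', sub_add_cancel_left, norm_neg, norm_smul, Real.norm_of_nonneg ht0.le]
    exact mul_le_of_le_one_right ht0.le
      (BoundedContinuousFunction.norm_ofNormedAddCommGroup_le _ zero_le_one hv1)
  have h3 := hkmin k'
  nlinarith

/-- `HasOddFamilyBelow J b j` says that `J ≤ b` on the image under an odd map `h` of the zero set of
`p` odd functions on a subspace of dimension at least `p + j`, where `h` is the inclusion outside a
ball, in a region where `J ≤ 0`. -/
def HasOddFamilyBelow {X : Type*} [NormedAddCommGroup X] [NormedSpace ℝ X] (J : X → ℝ) (b : ℝ)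
    (j : ℕ) : Prop :=
  ∃ (W : Submodule ℝ X) (p : ℕ) (h : W → X) (f : W → Fin p → ℝ) (R : ℝ),
    FiniteDimensional ℝ W ∧ p + j ≤ Module.finrank ℝ W ∧
    Continuous h ∧ (∀ x, h (-x) = -h x) ∧ Continuous f ∧ (∀ x, f (-x) = -f x) ∧
    (∀ x, R ≤ ‖x‖ → h x = x ∧ J x ≤ 0) ∧ ∀ x, f x = 0 → J (h x) ≤ b

theorem continuous_finAppend {V α : Type*} [TopologicalSpace V] [TopologicalSpace α] {m n : ℕ}
    {f : V → Fin m → α} {g : V → Fin n → α} (hf : Continuous f) (hg : Continuous g) :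
    Continuous fun x => Fin.append (f x) (g x) := by
  refine continuous_pi fun i => ?_
  refine Fin.addCases (fun i => ?_) (fun i => ?_) i
  · simpa using continuous_pi_iff.1 hf i
  · simpa using continuous_pi_iff.1 hg i

theorem finAppend_neg {m n : ℕ} (u : Fin m → ℝ) (v : Fin n → ℝ) :
    Fin.append (-u) (-v) = -Fin.append u v := by
  ext i
  refine Fin.addCases (fun i => ?_) (fun i => ?_) i <;> simp

theorem finAppend_eq_zero {m n : ℕ} {u : Fin m → ℝ} {v : Fin n → ℝ} (h : Fin.append u v = 0) :
    u = 0 ∧ v = 0 :=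
  ⟨funext fun i => by simpa using congrFun h (Fin.castAdd n i),
    funext fun i => by simpa using congrFun h (Fin.natAdd m i)⟩

section HasOddFamilyBelow

variable {X : Type*} [NormedAddCommGroup X] [NormedSpace ℝ X] {J : X → ℝ}

theorem HasOddFamilyBelow.mono {b b' : ℝ} {j : ℕ} (h : HasOddFamilyBelow J b j) (hb : b ≤ b') :
    HasOddFamilyBelow J b' j := by
  obtain ⟨W, p, h, f, R, h1, h2, h3, h4, h5, h6, h7, h8⟩ := h
  exact ⟨W, p, h, f, R, h1, h2, h3, h4, h5, h6, h7, fun x hx => (h8 x hx).trans hb⟩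

theorem exists_hasOddFamilyBelow (hinf : ¬ FiniteDimensional ℝ X) (hJ : Continuous J)
    (hW : ∀ W : Subspace ℝ X, FiniteDimensional ℝ W →
      ∃ R > (0 : ℝ), ∀ u ∈ W, R ≤ ‖u‖ → J u ≤ 0) (j : ℕ) :
    ∃ b, HasOddFamilyBelow J b j := by
  have hrank : (j : Cardinal) ≤ Module.rank ℝ X := by
    refine (Cardinal.natCast_le_aleph0).trans (not_lt.1 fun h => hinf ?_)
    exact Module.rank_lt_aleph0_iff.1 h
  obtain ⟨t, ht, hli⟩ := le_rank_iff_exists_linearIndependent_finset.1 hrank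
  have hfin : FiniteDimensional ℝ (Submodule.span ℝ (t : Set X)) := inferInstance
  obtain ⟨R, -, hR⟩ := hW (Submodule.span ℝ (t : Set X)) hfin
  have := FiniteDimensional.proper_real (Submodule.span ℝ (t : Set X))
  obtain ⟨b, hb⟩ := ((isCompact_closedBall (0 : Submodule.span ℝ (t : Set X)) R).image
    (hJ.comp continuous_subtype_val)).bddAbove
  refine ⟨max b 0, Submodule.span ℝ (t : Set X), 0, Subtype.val, fun _ => 0, R, hfin, ?_,
    continuous_subtype_val, fun _ => rfl, continuous_const, fun _ => by simp,
    fun x hx => ⟨rfl, hR x x.2 hx⟩, fun x _ => ?_⟩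
  · rw [zero_add, ← ht, finrank_span_finset_eq_card hli]
  · rcases le_total R ‖x‖ with h | h
    · exact (hR x x.2 h).trans (le_max_right _ _)
    · exact (hb ⟨x, by simpa using h, rfl⟩).trans (le_max_left _ _)

theorem not_hasOddFamilyBelow {k : ℕ} (P : X →L[ℝ] (Fin k → ℝ)) {ρ a b : ℝ} (hρ : 0 < ρ)
    (hP : ∀ u, P u = 0 → ‖u‖ = ρ → a ≤ J u) (hb : b < a) : ¬ HasOddFamilyBelow J b (k + 1) := by
  rintro ⟨W, p, h, f, R, hfin, hp, hh, hhodd, hf, hfodd, hR, hle⟩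
  let e : (Fin (p + k + 1) → ℝ) →ₗ[ℝ] W :=
    Fintype.linearCombination ℝ (Module.finBasis ℝ W ∘ Fin.castLE (by omega))
  have he : Function.Injective e := by
    exact linearIndependent_iff_injective_fintypeLinearCombination.1
      ((Module.finBasis ℝ W).linearIndependent.comp _ (Fin.castLE_injective _))
  obtain ⟨K, hK, hanti⟩ := e.injective_iff_antilipschitz.1 he
  have hec : Continuous e := e.continuous_of_finiteDimensional
  have hh0 : h 0 = 0 := by
    have : IsAddTorsionFree X := .of_isTorsionFree ℝ X
    exact self_eq_neg.1 (by simpa using hhodd 0)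
  obtain ⟨x, hx, hxg⟩ := exists_zero_of_odd_of_even
    (f := fun x => Fin.append (f (e x)) (P (h (e x)))) (g := fun x => ‖h (e x)‖ - ρ)
    (R := K * max R ρ) (continuous_finAppend (by fun_prop) (by fun_prop)) (by fun_prop)
    (fun x => by rw [map_neg, hfodd, hhodd, map_neg, finAppend_neg])
    (fun x => by rw [map_neg, hhodd, norm_neg]) (by simpa [hh0] using hρ)
    (fun x hx => by
      have h1 : ‖x‖ ≤ K * ‖e x‖ := by
        simpa using hanti.le_mul_dist x 0
      have h2 : max R ρ ≤ ‖e x‖ :=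
        le_of_mul_le_mul_left (hx.trans h1) (NNReal.coe_pos.2 hK)
      rw [(hR _ ((le_max_left _ _).trans h2)).1, sub_nonneg]
      exact (le_max_right _ _).trans h2)
  obtain ⟨hx1, hx2⟩ := finAppend_eq_zero hx
  linarith [hP _ hx2 (sub_eq_zero.1 hxg), hle _ hx1]

theorem exists_clm_forall_le_of_isCompl {Y Z : Subspace ℝ X} (hY : FiniteDimensional ℝ Y)
    (hYZ : IsCompl Y Z) (hJ : Continuous J) {ρ a : ℝ} (hρ : 0 < ρ)
    (hZ : ∀ u ∈ Z, ‖u‖ = ρ → a ≤ J u) :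
    ∃ (k : ℕ) (P : X →L[ℝ] (Fin k → ℝ)), ∀ u, P u = 0 → ‖u‖ = ρ → a ≤ J u := by
  let N := Z.topologicalClosure
  have hN : IsClosed (N : Set X) := Z.isClosed_topologicalClosure
  have : FiniteDimensional ℝ (X ⧸ N) := by
    refine Module.Finite.of_surjective (N.mkQ ∘ₗ Y.subtype) fun q => ?_
    obtain ⟨u, rfl⟩ := N.mkQ_surjective q
    obtain ⟨y, hy, z, hz, rfl⟩ := Submodule.mem_sup.1
      (hYZ.sup_eq_top ▸ Submodule.mem_top : u ∈ Y ⊔ Z)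
    refine ⟨⟨y, hy⟩, ?_⟩
    have : N.mkQ z = 0 := by simpa using Z.le_topologicalClosure hz
    simp only [LinearMap.comp_apply, Submodule.subtype_apply, map_add, this, add_zero]
  let e := (Module.finBasis ℝ (X ⧸ N)).equivFun.toContinuousLinearEquiv
  refine ⟨_, e.toContinuousLinearMap.comp N.mkQL, fun u hu huρ => ?_⟩
  have huN : u ∈ N := by
    have : N.mkQ u = 0 := e.injective (hu.trans e.map_zero.symm)
    simpa using this
  obtain ⟨z, hz, hlim⟩ := mem_closure_iff_seq_limit.1 huN
  have hu0 : ‖u‖ ≠ 0 := by rw [huρ]; exact hρ.ne'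
  have hlim' : Filter.Tendsto (fun n => (ρ / ‖z n‖) • z n) Filter.atTop (nhds u) := by
    have := ((tendsto_const_nhds (x := ρ)).div hlim.norm hu0).smul hlim
    rwa [huρ, div_self hρ.ne', one_smul] at this
  refine ge_of_tendsto ((hJ.tendsto u).comp hlim') ?_
  filter_upwards [hlim.norm.eventually_ne hu0] with n hn
  refine hZ _ (Z.smul_mem _ (hz n)) ?_
  rw [norm_smul, norm_div, norm_norm, Real.norm_of_nonneg hρ.le, div_mul_cancel₀ _ hn]

theorem exists_hasOddFamilyBelow_sub_of_add [CompleteSpace X] {J' : X → (X →L[ℝ] ℝ)}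
    (hJdiff : ∀ x, HasFDerivAt J (J' x) x) (hJ'cont : Continuous J')
    (hPS : ∀ un : ℕ → X, (∃ B, ∀ n, |J (un n)| ≤ B) →
      Filter.Tendsto (fun n => ‖J' (un n)‖) Filter.atTop (nhds 0) →
      ∃ (ψ : ℕ → ℕ) (x : X), StrictMono ψ ∧
        Filter.Tendsto (fun n => un (ψ n)) Filter.atTop (nhds x))
    (hJ0 : J 0 = 0) (hJeven : ∀ u : X, J (-u) = J u) {c : ℝ} (hc : 0 < c) :
    ∃ ε > 0, ∃ q : ℕ, ((∀ u, J' u = 0 → J u ≠ c) → q = 0) ∧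
      ∀ j, HasOddFamilyBelow J (c + ε) (j + q) → HasOddFamilyBelow J (c - ε) j := by
  have hJ : ∀ x, HasStrictFDerivAt J (J' x) x := fun x =>
    hasStrictFDerivAt_of_hasFDerivAt_of_continuousAt (Filter.Eventually.of_forall hJdiff)
      hJ'cont.continuousAt
  have hJc : Continuous J := continuous_iff_continuousAt.2 fun x => (hJ x).continuousAt
  have hodd : ∀ u, J' (-u) = -J' u := fun u => by
    have h1 := (hJdiff (-u)).comp u (hasFDerivAt_id u).neg
    have h2 : J ∘ (fun x => -id x) = J := funext hJeven
    have h3 := (h2 ▸ h1).unique (hJdiff u)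
    rw [← h3]
    ext w
    simp
  let K : Set X := {u | J' u = 0 ∧ J u = c}
  obtain ⟨q, g, δ, hδ, hq, hg⟩ := exists_clm_ne_zero_on_thickening
    (isCompact_criticalSet hJc hJ'cont hPS c) fun h => hc.ne (hJ0.symm.trans h.2)
  obtain ⟨σ, hσ, hσle⟩ := exists_pos_le_norm_derivative hJc hJ'cont hPS c
    (N := Metric.thickening (δ / 2) K) Metric.isOpen_thickening
    fun u h1 h2 => Metric.self_subset_thickening (half_pos hδ) K ⟨h1, h2⟩
  let ε := min (min σ c) (σ * δ / 16)
  have hε : 0 < ε := by positivity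
  have hεσ : ε ≤ σ := (min_le_left _ _).trans (min_le_left _ _)
  have hεc : ε ≤ c := (min_le_left _ _).trans (min_le_right _ _)
  have hεδ : ε ≤ σ * δ / 16 := min_le_right _ _
  refine ⟨ε, hε, q, fun h => hq (Set.eq_empty_of_forall_notMem fun u hu => h u hu.1 hu.2),
    fun j => ?_⟩
  rintro ⟨W, p, h, f, R, hfin, hp, hh, hhodd, hf, hfodd, hR, hle⟩
  have := FiniteDimensional.proper_real W
  obtain ⟨k, hk, hkodd, hkR, hkle⟩ := exists_odd_perturbation_forall_le (R := R) (c := c) (ε := ε)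
    (l := δ / 2) (κ := σ / 4) (s := σ / 2)
    (C := Metric.closedBall 0 R ∩ {x | f x = 0 ∧ g (h x) = 0}) hJ hJ'cont hodd hJeven hh hhodd
    ((isCompact_closedBall _ _).inter_right ((isClosed_eq hf continuous_const).inter
      (isClosed_eq (g.continuous.comp hh) continuous_const)))
    (fun x ⟨h1, h2, h3⟩ => ⟨by simpa using h1, by rw [hfodd, h2, neg_zero],
      by rw [hhodd, map_neg, h3, neg_zero]⟩)
    (by positivity) (by linarith) (by linarith) (fun x hx => hle x hx.2.1)
    (fun x hx => by rw [(hR x hx).1]; linarith [(hR x hx).2])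
    (fun x hx u hu hJu => by
      refine (half_lt_self hσ).trans_le (hσle u (hJu.trans hεσ) fun huK => ?_)
      refine hg (h x) ?_ hx.2.2
      obtain ⟨z, hz, hzu⟩ := Metric.mem_thickening_iff.1 huK
      refine Metric.mem_thickening_iff.2 ⟨z, hz, ?_⟩
      have := dist_triangle_left (h x) z u
      rw [← dist_eq_norm] at hu
      linarith)
  refine ⟨W, p + q, fun x => h x + k x, fun x => Fin.append (f x) (g (h x)), R, hfin, by omega,
    hh.add hk, fun x => by beta_reduce; rw [hhodd, hkodd, neg_add],
    continuous_finAppend hf (g.continuous.comp hh),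
    fun x => by beta_reduce; rw [hfodd, hhodd, map_neg, finAppend_neg],
    fun x hx => ⟨by beta_reduce; rw [hkR x hx, add_zero, (hR x hx).1], (hR x hx).2⟩, fun x hx => ?_⟩
  rcases le_total R ‖x‖ with hxR | hxR
  · beta_reduce
    rw [hkR x hxR, add_zero, (hR x hxR).1]
    linarith [(hR x hxR).2]
  · exact hkle x ⟨by simpa using hxR, finAppend_eq_zero hx⟩

end HasOddFamilyBelow

/-- Symmetric Mountain Pass Theorem. -/
theorem symmetric_mountain_pass
    (X : Type*) [NormedAddCommGroup X] [NormedSpace ℝ X] [CompleteSpace X]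
    (hinf : ¬ FiniteDimensional ℝ X)
    (Y Z : Subspace ℝ X) (hY : FiniteDimensional ℝ Y) (hYZ : IsCompl Y Z)
    (J : X → ℝ) (J' : X → (X →L[ℝ] ℝ))
    (hJdiff : ∀ x, HasFDerivAt J (J' x) x) (hJ'cont : Continuous J')
    (hPS : ∀ un : ℕ → X, (∃ B, ∀ n, |J (un n)| ≤ B) →
      Filter.Tendsto (fun n => ‖J' (un n)‖) Filter.atTop (nhds 0) →
      ∃ (ψ : ℕ → ℕ) (x : X), StrictMono ψ ∧
        Filter.Tendsto (fun n => un (ψ n)) Filter.atTop (nhds x))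
    (hJ0 : J 0 = 0) (hJeven : ∀ u : X, J (-u) = J u)
    (ρ a : ℝ) (hρ : 0 < ρ) (ha : 0 < a)
    (hZ : ∀ u ∈ Z, ‖u‖ = ρ → a ≤ J u)
    (hW : ∀ W : Subspace ℝ X, FiniteDimensional ℝ W →
      ∃ R > (0 : ℝ), ∀ u ∈ W, R ≤ ‖u‖ → J u ≤ 0) :
    ∃ c : ℕ → ℝ, Filter.Tendsto c Filter.atTop Filter.atTop ∧
      ∀ j : ℕ, ∃ u : X, J' u = 0 ∧ J u = c j := by
  suffices hex : ∀ M : ℝ, 0 < M → ∃ u, J' u = 0 ∧ M ≤ J u by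
    choose u hu hMu using fun j : ℕ => hex (j + 1) (by positivity)
    refine ⟨fun j => J (u j), ?_, fun j => ⟨u j, hu j, rfl⟩⟩
    refine Filter.tendsto_atTop_mono (fun j => ?_) tendsto_natCast_atTop_atTop
    linarith [hMu j]
  intro M hM
  by_contra! hcrit
  have hJc : Continuous J := continuous_iff_continuousAt.2 fun x => (hJdiff x).continuousAt
  have hstep : ∀ c : ℝ, 0 < c → _ := fun c hc =>
    exists_hasOddFamilyBelow_sub_of_add hJdiff hJ'cont hPS hJ0 hJeven (c := c) hc
  obtain ⟨k, P, hP⟩ := exists_clm_forall_le_of_isCompl hY hYZ hJc hρ hZ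
  have hlow : ¬ HasOddFamilyBelow J (a / 2) (k + 1) :=
    not_hasOddFamilyBelow P hρ hP (half_lt_self ha)
  obtain ⟨j, hj⟩ : ∃ j, ¬ HasOddFamilyBelow J M j := by
    by_contra! hall
    let A : Set ℝ := {b | ∃ j, ¬ HasOddFamilyBelow J b j}
    have hAne : a / 2 ∈ A := ⟨_, hlow⟩
    have hAb : BddAbove A := ⟨M, fun b ⟨j, hj⟩ => not_lt.1 fun hb => hj ((hall j).mono hb.le)⟩
    obtain ⟨ε, hε, q, -, hq⟩ := hstep (sSup A) ((half_pos ha).trans_le (le_csSup hAb hAne))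
    obtain ⟨b, ⟨j, hj⟩, hb⟩ := exists_lt_of_lt_csSup ⟨_, hAne⟩ (sub_lt_self (sSup A) hε)
    have h1 : sSup A + ε ∈ A := ⟨j + q, fun h => hj ((hq j h).mono hb.le)⟩
    linarith [le_csSup hAb h1]
  let B : Set ℝ := {b | ¬ HasOddFamilyBelow J b j}
  obtain ⟨b₀, hb₀⟩ := exists_hasOddFamilyBelow hinf hJc hW j
  have hBb : BddAbove B := ⟨b₀, fun b hb => not_lt.1 fun hlt => hb (hb₀.mono hlt.le)⟩
  have hMB : M ≤ sSup B := le_csSup hBb hj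
  obtain ⟨ε, hε, q, hq0, hq⟩ := hstep (sSup B) (hM.trans_le hMB)
  obtain rfl : q = 0 := hq0 fun u hu => ((hcrit u hu).trans_le hMB).ne
  obtain ⟨b, hbB, hb⟩ := exists_lt_of_lt_csSup ⟨_, hj⟩ (sub_lt_self (sSup B) hε)
  have h1 : sSup B + ε ∈ B := fun h => hbB ((hq j h).mono hb.le)
  linarith [le_csSup hBb h1]
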